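/- Suppose σ₁, σ₂ : B → ℝ are C¹ functions on a simply connected open set B ⊂ ℝ² satisfying ∂_v σ₁ = ∂_u σ₂. Then there exists a C² function φ : B → ℝ with φ_u = −σ₁ and φ_v = −σ₂. Consequently, if a C² orthonormal normal section {N₁, N₂} has torsion coefficients σ_{1,1}² = σ₁, σ_{1,2}² = σ₂ satisfying this compatibility condition, the rotated section Ñ₁ = cos φ N₁ + sin φ N₂, Ñ₂ = sin φ N₁ − cos φ N₂ is torsion-free: ∂_{u^i} Ñ₁ · Ñ₂ = 0 for i = 1, 2. -/

import Mathlib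

noncomputable section

/-- the two coordinate directions in the parameter domain -/
def dir : Fin 2 → ℝ × ℝ := ![(1, 0), (0, 1)]

/-- partial derivative in the `i`-th coordinate direction -/
def pd {E : Type*} [NormedAddCommGroup E] [NormedSpace ℝ E]
    (i : Fin 2) (X : ℝ × ℝ → E) (p : ℝ × ℝ) : E := fderiv ℝ X p (dir i)

def dot {n : ℕ} (f g : Fin n → ℝ) : ℝ := ∑ i, f i * g i

/-- torsion coefficients `σ_{Σ,i}^Ω = ∂_{u^i} N_Σ · N_Ω` -/
def tors (N : Fin 2 → ℝ × ℝ → Fin 4 → ℝ) (S : Fin 2) (i : Fin 2) (Ω : Fin 2)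
    (p : ℝ × ℝ) : ℝ := dot (pd i (N S) p) (N Ω p)

open Set Filter Topology Metric

/-- Functions `f i` given on an open cover of a simply connected space, any two of which differ by
a locally constant function where both are defined, differ by locally constant functions from a
single globally defined function. -/
theorem exists_forall_eventually_sub_eq_sub {X ι M : Type*} [TopologicalSpace X]
    [SimplyConnectedSpace X] [LocallyPathConnectedSpace X] [AddCommGroup M]
    (U : ι → Set X) (hU : ∀ i, IsOpen (U i)) (hcover : ∀ x, ∃ i, x ∈ U i) (f : ι → X → M)
    (hf : ∀ i j, ∀ x ∈ U i ∩ U j, ∀ᶠ y in 𝓝 x, f i y - f j y = f i x - f j x) :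
    ∃ φ : X → M, ∀ i, ∀ x ∈ U i, ∀ᶠ y in 𝓝 x, φ y - f i y = φ x - f i x := by
  let _ : TopologicalSpace M := ⊥
  have : DiscreteTopology M := ⟨rfl⟩
  choose idx hidx using hcover
  let Z : FiberBundleCore ι X M :=
    { baseSet := U
      isOpen_baseSet := hU
      indexAt := idx
      mem_baseSet_at := hidx
      coordChange := fun i j x v => f i x - f j x + v
      coordChange_self := by simp
      continuousOn_coordChange := by
        rintro i j ⟨x, v⟩ ⟨hx, -⟩
        refine ContinuousAt.continuousWithinAt ?_
        have hcont : ContinuousAt (fun y => f i y - f j y) x :=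
          continuousAt_const.congr ((hf i j x hx).mono fun _ h => h.symm)
        exact (ContinuousAt.comp (x := (x, v)) (f := Prod.fst) hcont continuousAt_fst).add
          continuousAt_snd
      coordChange_comp := by intros; abel }
  have hcov : IsCoveringMap Z.proj := .mk _ (fun _ => M) (fun x => Z.localTrivAt x) hidx
  obtain ⟨x₀⟩ : Nonempty X := inferInstance
  obtain ⟨s, ⟨-, hs⟩, -⟩ :=
    hcov.existsUnique_continuousMap_lifts (ContinuousMap.id X) x₀ ⟨x₀, (0 : M)⟩ rfl
  have hproj (x : X) : (s x).proj = x := congrFun hs x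
  let val : Z.TotalSpace → M := fun e => f (idx e.proj) e.proj + (show M from e.snd)
  refine ⟨fun x => val (s x), fun i x hx => ?_⟩
  have hcoord (y : X) : val (s y) - f i y = (Z.localTriv i (s y)).2 := by
    change f (idx (s y).proj) (s y).proj + (show M from (s y).snd) - f i y =
      f (idx (s y).proj) (s y).proj - f i (s y).proj + (show M from (s y).snd)
    rw [hproj y]
    abel
  have hcont : ContinuousAt (fun y => (Z.localTriv i (s y)).2) x := by
    refine continuousAt_snd.comp (ContinuousAt.comp ?_ s.continuous.continuousAt)
    refine (Z.localTriv i).continuousAt ?_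
    rw [(Z.localTriv i).mem_source]
    change (s x).proj ∈ U i
    rwa [hproj]
  simp only [hcoord]
  exact hcont.eventually (mem_nhds_discrete.2 rfl : ({_} : Set M) ∈ 𝓝 _)

section Poincare

variable {E F : Type*} [NormedAddCommGroup E] [NormedSpace ℝ E]
  [NormedAddCommGroup F] [NormedSpace ℝ F]

theorem eventually_sub_eq_sub_of_hasFDerivAt {ω : E → E →L[ℝ] F} {f g : E → F} {x : E}
    (hf : ∀ᶠ y in 𝓝 x, HasFDerivAt f (ω y) y) (hg : ∀ᶠ y in 𝓝 x, HasFDerivAt g (ω y) y) :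
    ∀ᶠ y in 𝓝 x, f y - g y = f x - g x := by
  obtain ⟨r, hr, h⟩ := Metric.eventually_nhds_iff_ball.1 (hf.and hg)
  have hd (y : E) (hy : y ∈ ball x r) : HasFDerivAt (fun y => f y - g y) (0 : E →L[ℝ] F) y := by
    simpa using (h y hy).1.fun_sub (h y hy).2
  filter_upwards [ball_mem_nhds x hr] with y hy
  exact isOpen_ball.is_const_of_fderiv_eq_zero (convex_ball x r).isPreconnected
    (fun z hz => (hd z hz).differentiableAt.differentiableWithinAt)
    (fun z hz => (hd z hz).fderiv) hy (mem_ball_self hr)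

/-- **Poincaré lemma** for 1-forms: a closed 1-form on a simply connected open set is exact. -/
theorem IsSimplyConnected.exists_forall_hasFDerivAt_of_fderiv_symmetric [CompleteSpace F]
    {s : Set E} (hs : IsSimplyConnected s) (hso : IsOpen s) {ω : E → E →L[ℝ] F}
    (hω : DifferentiableOn ℝ ω s)
    (hdω : ∀ a ∈ s, ∀ x y, fderiv ℝ ω a x y = fderiv ℝ ω a y x) :
    ∃ f : E → F, ∀ a ∈ s, HasFDerivAt f (ω a) a := by
  classical
  have := hs.simplyConnectedSpace
  have := hso.locallyPathConnectedSpace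
  have hloc (a : s) : ∃ r > 0, ∃ f : E → F, ball (a : E) r ⊆ s ∧
      ∀ x ∈ ball (a : E) r, HasFDerivAt f (ω x) x := by
    obtain ⟨r, hr, hrs⟩ := Metric.isOpen_iff.1 hso a a.2
    obtain ⟨f, hf⟩ := (convex_ball (a : E) r).exists_forall_hasFDerivAt_of_fderiv_symmetric
      isOpen_ball (hω.mono hrs) fun x hx => hdω x (hrs hx)
    exact ⟨r, hr, f, hrs, hf⟩
  choose r hr f hrs hf using hloc
  have hnhds (a : s) (x : E) (hx : x ∈ ball (a : E) (r a)) :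
      ∀ᶠ y in 𝓝 x, HasFDerivAt (f a) (ω y) y :=
    eventually_of_mem (isOpen_ball.mem_nhds hx) (hf a)
  obtain ⟨φ, hφ⟩ := exists_forall_eventually_sub_eq_sub
    (fun a : s => ((↑) : s → E) ⁻¹' ball (a : E) (r a))
    (fun a => isOpen_ball.preimage continuous_subtype_val)
    (fun a => ⟨a, mem_ball_self (hr a)⟩) (fun a x => f a x)
    (fun a b x hx => continuous_subtype_val.continuousAt.eventually
      (eventually_sub_eq_sub_of_hasFDerivAt (hnhds a x hx.1) (hnhds b x hx.2)))
  refine ⟨fun x => if hx : x ∈ s then φ ⟨x, hx⟩ else 0, fun a ha => ?_⟩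
  lift a to s using ha
  have hev := hφ a a (mem_ball_self (hr a))
  rw [nhds_subtype_eq_comap, eventually_comap] at hev
  refine ((hf a a (mem_ball_self (hr a))).add_const (φ a - f a a)).congr_of_eventuallyEq ?_
  filter_upwards [hev, hso.mem_nhds a.2] with y hy hys
  rw [dif_pos hys, ← hy ⟨y, hys⟩ rfl]
  abel

end Poincare

theorem fderiv_dot {E : Type*} [NormedAddCommGroup E] [NormedSpace ℝ E] {n : ℕ}
    {X Y : E → Fin n → ℝ} {p : E} (hX : DifferentiableAt ℝ X p) (hY : DifferentiableAt ℝ Y p)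
    (v : E) :
    fderiv ℝ (fun q => dot (X q) (Y q)) p v =
      dot (fderiv ℝ X p v) (Y p) + dot (X p) (fderiv ℝ Y p v) := by
  have hcomp {Z : E → Fin n → ℝ} (hZ : DifferentiableAt ℝ Z p) (k : Fin n) :
      HasFDerivAt (fun q => Z q k) ((ContinuousLinearMap.proj k).comp (fderiv ℝ Z p)) p :=
    hasFDerivAt_pi'.1 hZ.hasFDerivAt k
  have h := HasFDerivAt.fun_sum (u := Finset.univ)
    fun k _ => (hcomp hX k).fun_mul (hcomp hY k)
  simp only [dot]
  rw [h.fderiv]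
  simp only [sum_apply, ← Finset.sum_add_distrib]
  refine Finset.sum_congr rfl fun k _ => ?_
  simp
  ring

/-- A rotation through an angle `φ` of an orthonormal pair `A`, `C` changes the torsion in the
direction `v` into `-(∂_v φ + ∂_v A · C)`. -/
theorem dot_fderiv_rotate {E : Type*} [NormedAddCommGroup E] [NormedSpace ℝ E] {n : ℕ}
    {A C : E → Fin n → ℝ} {φ : E → ℝ} {p : E} (hA : DifferentiableAt ℝ A p)
    (hC : DifferentiableAt ℝ C p) (hφ : DifferentiableAt ℝ φ p)
    (hAA : ∀ᶠ q in 𝓝 p, dot (A q) (A q) = 1) (hCC : ∀ᶠ q in 𝓝 p, dot (C q) (C q) = 1)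
    (hAC : ∀ᶠ q in 𝓝 p, dot (A q) (C q) = 0) (v : E) :
    dot (fderiv ℝ (fun q => Real.cos (φ q) • A q + Real.sin (φ q) • C q) p v)
        (Real.sin (φ p) • A p - Real.cos (φ p) • C p) =
      -(fderiv ℝ φ p v + dot (fderiv ℝ A p v) (C p)) := by
  have hconst {X Y : E → Fin n → ℝ} {c : ℝ} (hX : DifferentiableAt ℝ X p)
      (hY : DifferentiableAt ℝ Y p) (h : ∀ᶠ q in 𝓝 p, dot (X q) (Y q) = c) :
      dot (fderiv ℝ X p v) (Y p) + dot (X p) (fderiv ℝ Y p v) = 0 := by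
    rw [← fderiv_dot hX hY, EventuallyEq.fderiv_eq (f := fun _ => c) h]
    simp
  have hrot := (hφ.hasFDerivAt.cos.fun_smul hA.hasFDerivAt).fun_add
    (hφ.hasFDerivAt.sin.fun_smul hC.hasFDerivAt)
  have hcomm (x y : Fin n → ℝ) : dot x y = dot y x := by simp [dot, mul_comm]
  have hadd (x y z : Fin n → ℝ) : dot (x + y) z = dot x z + dot y z := by
    simp [dot, add_mul, Finset.sum_add_distrib]
  have hsmul (c : ℝ) (x y : Fin n → ℝ) : dot (c • x) y = c * dot x y := by
    simp [dot, Finset.mul_sum, mul_assoc]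
  have hsub' (x y z : Fin n → ℝ) : dot x (y - z) = dot x y - dot x z := by
    simp [dot, mul_sub, Finset.sum_sub_distrib]
  have hsmul' (c : ℝ) (x y : Fin n → ℝ) : dot x (c • y) = c * dot x y := by
    rw [hcomm, hsmul, hcomm]
  have eAA := hconst hA hA hAA
  have eCC := hconst hC hC hCC
  have eAC := hconst hA hC hAC
  rw [hcomm (A p)] at eAA eAC
  rw [hcomm (C p)] at eCC
  have eA : dot (fderiv ℝ A p v) (A p) = 0 := by linarith
  have eC : dot (fderiv ℝ C p v) (C p) = 0 := by linarith
  have eCA : dot (fderiv ℝ C p v) (A p) = -dot (fderiv ℝ A p v) (C p) := by linarith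
  rw [hrot.fderiv]
  simp only [add_apply, smul_apply, ContinuousLinearMap.smulRight_apply, hadd, hsmul, hsub',
    hsmul', smul_eq_mul, eA, eC, eCA, hAA.self_of_nhds, hCC.self_of_nhds, hAC.self_of_nhds,
    hcomm (C p) (A p)]
  linear_combination (-(fderiv ℝ φ p v) - dot (fderiv ℝ A p v) (C p)) *
    Real.sin_sq_add_cos_sq (φ p)


/-- on a simply connected domain, compatible torsion coefficients
admit a potential `φ` with `φ_u = -σ₁`, `φ_v = -σ₂`, and the correspondingly
rotated orthonormal normal section is torsion-free. -/
theorem stmt12 (σ₁ σ₂ : ℝ × ℝ → ℝ) (N : Fin 2 → ℝ × ℝ → Fin 4 → ℝ)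
    (B : Set (ℝ × ℝ)) (hB : IsOpen B) (hsc : SimplyConnectedSpace B)
    (hσ₁ : ContDiffOn ℝ 1 σ₁ B) (hσ₂ : ContDiffOn ℝ 1 σ₂ B)
    (hcompat : ∀ p ∈ B, fderiv ℝ σ₁ p (0, 1) = fderiv ℝ σ₂ p (1, 0))
    (hreg : ∀ S, ContDiffOn ℝ 2 (N S) B)
    (hunit : ∀ S, ∀ p ∈ B, dot (N S p) (N S p) = 1)
    (horth : ∀ p ∈ B, dot (N 0 p) (N 1 p) = 0)
    (htors1 : ∀ p ∈ B, tors N 0 0 1 p = σ₁ p)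
    (htors2 : ∀ p ∈ B, tors N 0 1 1 p = σ₂ p) :
    ∃ φ : ℝ × ℝ → ℝ, ContDiffOn ℝ 2 φ B ∧
      (∀ p ∈ B, fderiv ℝ φ p (1, 0) = - σ₁ p ∧ fderiv ℝ φ p (0, 1) = - σ₂ p) ∧
      (∀ i, ∀ p ∈ B,
        dot (pd i (fun q => Real.cos (φ q) • N 0 q + Real.sin (φ q) • N 1 q) p)
          (Real.sin (φ p) • N 0 p - Real.cos (φ p) • N 1 p) = 0) := by
  have hopen {p : ℝ × ℝ} (hp : p ∈ B) : B ∈ 𝓝 p := hB.mem_nhds hp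
  let ω : ℝ × ℝ → ℝ × ℝ →L[ℝ] ℝ := fun p =>
    (-σ₁ p) • ContinuousLinearMap.fst ℝ ℝ ℝ + (-σ₂ p) • ContinuousLinearMap.snd ℝ ℝ ℝ
  have hω : ContDiffOn ℝ 1 ω B :=
    (hσ₁.neg.smul contDiffOn_const).add (hσ₂.neg.smul contDiffOn_const)
  have hdω : ∀ p ∈ B, ∀ x y, fderiv ℝ ω p x y = fderiv ℝ ω p y x := by
    intro p hp x y
    have h₁ := ((hσ₁.contDiffAt (hopen hp)).differentiableAt one_ne_zero).hasFDerivAt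
    have h₂ := ((hσ₂.contDiffAt (hopen hp)).differentiableAt one_ne_zero).hasFDerivAt
    have h : HasFDerivAt ω _ p :=
      (h₁.fun_neg.smul_const (ContinuousLinearMap.fst ℝ ℝ ℝ)).fun_add
        (h₂.fun_neg.smul_const (ContinuousLinearMap.snd ℝ ℝ ℝ))
    have hsplit (L : ℝ × ℝ →L[ℝ] ℝ) (z : ℝ × ℝ) : L z = z.1 * L (1, 0) + z.2 * L (0, 1) := by
      rw [← smul_eq_mul, ← smul_eq_mul, ← map_smul, ← map_smul, ← map_add]
      simp
    rw [h.fderiv]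
    simp only [add_apply, neg_apply, smul_apply, ContinuousLinearMap.smulRight_apply,
      ContinuousLinearMap.coe_fst', ContinuousLinearMap.coe_snd', smul_eq_mul]
    rw [hsplit _ x, hsplit _ y, hsplit (fderiv ℝ σ₂ p) x, hsplit (fderiv ℝ σ₂ p) y,
      hcompat p hp]
    ring
  obtain ⟨φ, hφ⟩ := IsSimplyConnected.exists_forall_hasFDerivAt_of_fderiv_symmetric
    (s := B) hsc hB (hω.differentiableOn one_ne_zero) hdω
  have hpartial : ∀ p ∈ B, fderiv ℝ φ p (1, 0) = - σ₁ p ∧ fderiv ℝ φ p (0, 1) = - σ₂ p := by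
    intro p hp
    simp [(hφ p hp).fderiv, ω]
  refine ⟨φ, ?_, hpartial, fun i p hp => ?_⟩
  · rw [show (2 : WithTop ℕ∞) = 1 + 1 from one_add_one_eq_two.symm,
      contDiffOn_succ_iff_fderiv_of_isOpen hB]
    exact ⟨fun p hp => (hφ p hp).differentiableAt.differentiableWithinAt, by simp,
      hω.congr fun p hp => (hφ p hp).fderiv⟩
  · have hN (S : Fin 2) : DifferentiableAt ℝ (N S) p :=
      ((hreg S).contDiffAt (hopen hp)).differentiableAt two_ne_zero
    have h₁ := htors1 p hp
    have h₂ := htors2 p hp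
    simp only [tors, pd, dir] at h₁ h₂
    rw [pd, dot_fderiv_rotate (hN 0) (hN 1) (hφ p hp).differentiableAt
      (eventually_of_mem (hopen hp) (hunit 0)) (eventually_of_mem (hopen hp) (hunit 1))
      (eventually_of_mem (hopen hp) horth)]
    fin_cases i
    · simpa [dir, (hpartial p hp).1, neg_add_eq_zero] using h₁
    · simpa [dir, (hpartial p hp).2, neg_add_eq_zero] using h₂
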